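/- Let 3 ≤ c ≤ min{n,s}. Then the symbolic cube of the star configuration ideal decomposes as I_{c,F}^{(3)} = I_{c−2,F} + I_{c−1,F}·I_{c,F} + I_{c,F}^3. In particular, there exists an ideal J of R generated by at most C(s, c−3) + C(s, c−2)·C(s, c−1) homogeneous polynomials such that I_{c,F}^{(3)} = I_{c,F}^3 + J, i.e. sdefect(I_{c,F},3) ≤ C(s,c−3) + C(s,c−2)C(s,c−1). -/

import Mathlib

open MvPolynomial

/-- The star configuration ideal `I_{e,F} = ⋂_{|S| = e} ⟨F_i : i ∈ S⟩`. -/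
noncomputable def starIdeal {k : Type*} [Field k] {n s : ℕ}
    (F : Fin s → MvPolynomial (Fin (n + 1)) k) (e : ℕ) :
    Ideal (MvPolynomial (Fin (n + 1)) k) :=
  ⨅ (S : Finset (Fin s)) (_ : S.card = e), Ideal.span (F '' ↑S)

/-- The `m`-th symbolic power `I_{e,F}^{(m)} = ⋂_{|S| = e} ⟨F_i : i ∈ S⟩^m`. -/
noncomputable def starSymb {k : Type*} [Field k] {n s : ℕ}
    (F : Fin s → MvPolynomial (Fin (n + 1)) k) (e m : ℕ) :
    Ideal (MvPolynomial (Fin (n + 1)) k) :=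
  ⨅ (S : Finset (Fin s)) (_ : S.card = e), (Ideal.span (F '' ↑S)) ^ m

/-- `F i` is a nonzerodivisor modulo `Q + ⟨F_j : j ∈ T⟩` whenever `T ⊆ V` has fewer than `N`
elements and `i ∈ V \ T`. -/
def RegularModulo {R ι : Type*} [CommRing R] (F : ι → R) (Q : Ideal R) (V : Finset ι) (N : ℕ) :
    Prop :=
  ∀ T ⊆ V, T.card < N → ∀ i ∈ V, i ∉ T → ∀ y,
    F i * y ∈ Q ⊔ Ideal.span (F '' ↑T) → y ∈ Q ⊔ Ideal.span (F '' ↑T)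

/-- The ideal spanned by the monomials `∏ i, F i ^ a i` with exponent vector `a` satisfying `p`. -/
def monomialSpan {R ι : Type*} [CommRing R] [Fintype ι] (F : ι → R) (p : (ι → ℕ) → Prop) :
    Ideal R :=
  Ideal.span ((fun a : ι → ℕ => ∏ i, F i ^ a i) '' {a | p a})

section CommRing

variable {R ι : Type*} [CommRing R]

theorem Ideal.sup_pow_succ_le (A J : Ideal R) (m : ℕ) :
    (A ⊔ J) ^ (m + 1) ≤ A * (A ⊔ J) ^ m ⊔ J ^ (m + 1) := by
  induction m with
  | zero => simp
  | succ m ih =>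
    have h : J * (A ⊔ J) ^ (m + 1) ≤ A * (A ⊔ J) ^ (m + 1) ⊔ J ^ (m + 1 + 1) := by
      refine (Ideal.mul_mono_right ih).trans ?_
      rw [Ideal.mul_sup, mul_left_comm, ← pow_succ' J]
      refine sup_le_sup_right (Ideal.mul_mono_right ?_) _
      rw [pow_succ' (A ⊔ J)]
      exact Ideal.mul_mono_left le_sup_right
    rw [pow_succ' (A ⊔ J) (m + 1), Ideal.sup_mul]
    exact sup_le le_sup_left h

theorem Ideal.mem_sup_pow_of_mul_mem {Q J : Ideal R} {z y : R} {m : ℕ}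
    (hz : ∀ y, z * y ∈ Q ⊔ J ^ (m + 1) → y ∈ Q ⊔ J ^ (m + 1))
    (hy : z * y ∈ Q ⊔ (Ideal.span {z} ⊔ J) ^ (m + 1)) :
    y ∈ Q ⊔ (Ideal.span {z} ⊔ J) ^ m := by
  have h := sup_le_sup_left (Ideal.sup_pow_succ_le (Ideal.span {z}) J m) Q hy
  obtain ⟨q, hq, r, hr, hqr⟩ := Submodule.mem_sup.1 h
  obtain ⟨v, hv, w, hw, rfl⟩ := Submodule.mem_sup.1 hr
  obtain ⟨u, hu, rfl⟩ := Ideal.mem_span_singleton_mul.1 hv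
  have h1 : y - u ∈ Q ⊔ J ^ (m + 1) := by
    apply hz
    have : z * (y - u) = q + w := by linear_combination -hqr
    rw [this]
    exact Submodule.add_mem_sup hq hw
  have h2 : Q ⊔ J ^ (m + 1) ≤ Q ⊔ (Ideal.span {z} ⊔ J) ^ m :=
    sup_le_sup_left ((Ideal.pow_le_pow_right m.le_succ).trans
      (Ideal.pow_right_mono le_sup_right m)) Q
  rw [← sub_add_cancel y u]
  exact add_mem (h2 h1) (Ideal.mem_sup_right hu)

theorem span_image_insert [DecidableEq ι] (F : ι → R) (z : ι) (K : Finset ι) :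
    Ideal.span (F '' ↑(insert z K)) = Ideal.span {F z} ⊔ Ideal.span (F '' ↑K) := by
  rw [Finset.coe_insert, Set.image_insert_eq, Ideal.span_insert]

theorem RegularModulo.sup_span [DecidableEq ι] {F : ι → R} {Q : Ideal R} {V : Finset ι} {N : ℕ}
    (h : RegularModulo F Q V (N + 1)) {z : ι} (hz : z ∈ V) :
    RegularModulo F (Q ⊔ Ideal.span {F z}) (V.erase z) N := by
  intro T hT hTN i hi hiT y hy
  have hzT : z ∉ T := fun h => by simpa using hT h
  rw [sup_assoc, ← span_image_insert] at hy ⊢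
  refine h (insert z T) (Finset.insert_subset hz (hT.trans (Finset.erase_subset _ _))) ?_ i
    (Finset.mem_of_mem_erase hi) ?_ y hy
  · rw [Finset.card_insert_of_notMem hzT]; omega
  · rw [Finset.mem_insert, not_or]
    exact ⟨Finset.ne_of_mem_erase hi, hiT⟩

theorem RegularModulo.mem_sup_pow [DecidableEq ι] {F : ι → R} {Q : Ideal R} {V : Finset ι} {N : ℕ}
    (h : RegularModulo F Q V N) {T : Finset ι} (hT : T ⊆ V) (hTN : T.card < N) {x : ι}
    (hx : x ∈ V) (hxT : x ∉ T) (m : ℕ) {y : R} (hy : F x * y ∈ Q ⊔ Ideal.span (F '' ↑T) ^ m) :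
    y ∈ Q ⊔ Ideal.span (F '' ↑T) ^ m := by
  induction T using Finset.induction generalizing Q V N x m y with
  | empty =>
    cases m with
    | zero => simp
    | succ m => simpa using h ∅ hT hTN x hx hxT y (by simpa using hy)
  | insert z K hzK ihK =>
    rw [Finset.card_insert_of_notMem hzK] at hTN
    obtain ⟨hzV, hKV⟩ := Finset.insert_subset_iff.1 hT
    rw [Finset.mem_insert, not_or] at hxT
    rw [span_image_insert] at hy ⊢
    induction m generalizing y with
    | zero => simp
    | succ m ihm =>
      obtain ⟨N, rfl⟩ : ∃ N', N = N' + 1 := ⟨N - 1, by omega⟩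
      have hsub := Ideal.sup_pow_succ_le (Ideal.span {F z}) (Ideal.span (F '' ↑K)) m
      have hy' : F x * y ∈ (Q ⊔ Ideal.span {F z}) ⊔ Ideal.span (F '' ↑K) ^ (m + 1) := by
        refine (?_ : Q ⊔ _ ≤ _) hy
        rw [sup_assoc]
        exact sup_le_sup_left (hsub.trans (sup_le_sup_right Ideal.mul_le_left _)) _
      have hmem := ihK (h.sup_span hzV) (Finset.subset_erase.2 ⟨hKV, hzK⟩) (by omega)
        (Finset.mem_erase.2 ⟨hxT.1, hx⟩) hxT.2 (m + 1) hy'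
      obtain ⟨q', hq', w, hw, rfl⟩ := Submodule.mem_sup.1 hmem
      obtain ⟨q, hq, v, hv, rfl⟩ := Submodule.mem_sup.1 hq'
      obtain ⟨t, rfl⟩ := Ideal.mem_span_singleton'.1 hv
      have hw' : w ∈ (Ideal.span {F z} ⊔ Ideal.span (F '' ↑K)) ^ (m + 1) :=
        Ideal.pow_right_mono le_sup_right _ hw
      have hqw := Submodule.add_mem_sup hq hw'
      have hzt : F z * (F x * t) ∈ Q ⊔ (Ideal.span {F z} ⊔ Ideal.span (F '' ↑K)) ^ (m + 1) := by
        have : F z * (F x * t) = F x * (q + t * F z + w) - F x * (q + w) := by ring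
        rw [this]
        exact sub_mem hy (Ideal.mul_mem_left _ _ hqw)
      have ht := ihm (Ideal.mem_sup_pow_of_mul_mem
        (fun y hy => ihK h hKV (by omega) hzV hzK (m + 1) hy) hzt)
      have hzt' : F z * t ∈ Q ⊔ (Ideal.span {F z} ⊔ Ideal.span (F '' ↑K)) ^ (m + 1) := by
        obtain ⟨q₁, hq₁, r, hr, rfl⟩ := Submodule.mem_sup.1 ht
        rw [mul_add, pow_succ']
        exact Submodule.add_mem_sup (Ideal.mul_mem_left _ _ hq₁)
          (Ideal.mul_mem_mul (Ideal.mem_sup_left (Ideal.mem_span_singleton_self _)) hr)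
      have : q + t * F z + w = (q + w) + F z * t := by ring
      rw [this]
      exact add_mem hqw hzt'

theorem RegularModulo.mem_sup_pow_pred [DecidableEq ι] {F : ι → R} {Q : Ideal R} {V : Finset ι}
    {N : ℕ} (h : RegularModulo F Q V N) {S : Finset ι} (hS : S ⊆ V) (hSN : S.card ≤ N) {x : ι}
    (hx : x ∈ S) (m : ℕ) {y : R} (hy : F x * y ∈ Q ⊔ Ideal.span (F '' ↑S) ^ m) :
    y ∈ Q ⊔ Ideal.span (F '' ↑S) ^ (m - 1) := by
  cases m with
  | zero => simp
  | succ m =>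
    have hcard := Finset.card_erase_lt_of_mem hx
    rw [← Finset.insert_erase hx, span_image_insert] at hy ⊢
    exact Ideal.mem_sup_pow_of_mul_mem (fun y hy => h.mem_sup_pow
      ((Finset.erase_subset _ _).trans hS) (by omega) (hS hx) (Finset.notMem_erase _ _) _ hy) hy

theorem prod_pow_mem_span_pow [Fintype ι] [DecidableEq ι] (F : ι → R) (a : ι → ℕ) {S : Finset ι}
    {r : ℕ} (hr : r ≤ ∑ i ∈ S, a i) : ∏ i, F i ^ a i ∈ Ideal.span (F '' ↑S) ^ r := by
  refine Ideal.pow_le_pow_right hr ?_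
  rw [← Finset.prod_mul_prod_compl S]
  refine Ideal.mul_mem_right _ _ ?_
  rw [← Finset.prod_pow_eq_pow_sum]
  exact Ideal.prod_mem_prod fun i hi =>
    Ideal.pow_mem_pow (Ideal.subset_span (Set.mem_image_of_mem F hi)) _

theorem prod_pow_mem_monomialSpan [Fintype ι] {F : ι → R} {p : (ι → ℕ) → Prop} {a : ι → ℕ}
    (ha : p a) : ∏ i, F i ^ a i ∈ monomialSpan F p :=
  Ideal.subset_span ⟨a, ha, rfl⟩

theorem monomialSpan_le [Fintype ι] {F : ι → R} {p : (ι → ℕ) → Prop} {I : Ideal R} :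
    monomialSpan F p ≤ I ↔ ∀ a, p a → ∏ i, F i ^ a i ∈ I := by
  simp [monomialSpan, Ideal.span_le, Set.subset_def]

theorem monomialSpan_eq_top [Fintype ι] (F : ι → R) {p : (ι → ℕ) → Prop} (hp : p 0) :
    monomialSpan F p = ⊤ :=
  (Ideal.eq_top_iff_one _).2 (by simpa using prod_pow_mem_monomialSpan (F := F) hp)

theorem mul_prod_pow [Fintype ι] [DecidableEq ι] (F : ι → R) (x : ι) (a : ι → ℕ) :
    F x * ∏ i, F i ^ a i = ∏ i, F i ^ (a + Pi.single x 1 : ι → ℕ) i := by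
  simp only [Pi.add_apply, pow_add, Finset.prod_mul_distrib, mul_comm (F x)]
  congr 1
  rw [Finset.prod_eq_single x] <;> simp +contextual

theorem sum_add_single [DecidableEq ι] (S : Finset ι) (a : ι → ℕ) (x : ι) :
    ∑ i ∈ S, (a + Pi.single x 1 : ι → ℕ) i = ∑ i ∈ S, a i + if x ∈ S then 1 else 0 := by
  simp [Finset.sum_add_distrib]

/-- Symbolic powers of star configurations are spanned by monomials in the forms `F i`, also after
dividing out the monomial `∏ i, F i ^ b i` and working modulo `Q`. -/
theorem RegularModulo.mem_sup_monomialSpan [Fintype ι] [DecidableEq ι] {F : ι → R} {Q : Ideal R}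
    {V : Finset ι} {c : ℕ} (h : RegularModulo F Q V (c + 1)) (m : ℕ) (b : ι → ℕ) {f : R}
    (hf : ∀ S ⊆ V, S.card = c → f ∈ Q ⊔ Ideal.span (F '' ↑S) ^ (m - ∑ i ∈ S, b i)) :
    f ∈ Q ⊔ monomialSpan F fun a => ∀ S ⊆ V, S.card = c → m ≤ ∑ i ∈ S, a i + ∑ i ∈ S, b i := by
  induction c generalizing Q V m b f with
  | zero =>
    have hf := hf ∅ (Finset.empty_subset _) rfl
    rcases Nat.eq_zero_or_pos m with rfl | hm
    · simp [monomialSpan_eq_top]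
    · simp only [Finset.coe_empty, Set.image_empty, Ideal.span_empty, Finset.sum_empty,
        tsub_zero] at hf
      rw [Ideal.bot_pow hm.ne', sup_bot_eq] at hf
      exact Ideal.mem_sup_left hf
  | succ c ihc =>
    induction hw : ∑ i ∈ V, (m - b i) using Nat.strong_induction_on generalizing b f with
    | _ w ihw =>
    by_cases hb : ∀ i ∈ V, m ≤ b i
    · refine Ideal.mem_sup_right ?_
      rw [monomialSpan_eq_top F]
      · exact Submodule.mem_top
      intro S hS hSc
      obtain ⟨i, hi⟩ := Finset.card_pos.1 (by omega : 0 < S.card)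
      have := Finset.single_le_sum_of_canonicallyOrdered (f := b) hi
      have := hb i (hS hi)
      omega
    push Not at hb
    obtain ⟨j, hjV, hj⟩ := hb
    obtain ⟨x, hxV, hx⟩ := V.exists_min_image b ⟨j, hjV⟩
    have hxm : b x < m := (hx j hjV).trans_lt hj
    have hmod := ihc (h.sup_span hxV) (m - b x) b (f := f) (by
      intro S hS hSc
      obtain ⟨hSV, hxS⟩ := Finset.subset_erase.1 hS
      have := hf (insert x S) (Finset.insert_subset hxV hSV)
        (by rw [Finset.card_insert_of_notMem hxS, hSc])
      rw [Finset.sum_insert hxS, ← Nat.sub_sub, span_image_insert] at this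
      refine (?_ : Q ⊔ _ ≤ _) this
      generalize m - b x - ∑ i ∈ S, b i = r
      rw [sup_assoc]
      refine sup_le_sup_left ?_ _
      cases r with
      | zero => simp
      | succ r =>
        exact (Ideal.sup_pow_succ_le _ _ _).trans (sup_le_sup_right Ideal.mul_le_left _))
    have hle : (monomialSpan F fun a => ∀ S ⊆ V.erase x, S.card = c →
          m - b x ≤ ∑ i ∈ S, a i + ∑ i ∈ S, b i) ≤
        monomialSpan F fun a => ∀ S ⊆ V, S.card = c + 1 →
          m ≤ ∑ i ∈ S, a i + ∑ i ∈ S, b i := by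
      refine monomialSpan_le.2 fun a ha => prod_pow_mem_monomialSpan ?_
      intro S hS hSc
      obtain ⟨i, hiS, hi⟩ : ∃ i ∈ S, x ∉ S.erase i := by
        by_cases hxS : x ∈ S
        · exact ⟨x, hxS, Finset.notMem_erase _ _⟩
        · obtain ⟨i, hi⟩ := Finset.card_pos.1 (by omega : 0 < S.card)
          exact ⟨i, hi, fun h => hxS (Finset.mem_of_mem_erase h)⟩
      have h1 := ha (S.erase i)
        (Finset.subset_erase.2 ⟨(Finset.erase_subset _ _).trans hS, hi⟩)
        (by rw [Finset.card_erase_of_mem hiS, hSc]; rfl)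
      have h2 := Finset.add_sum_erase S a hiS
      have h3 := Finset.add_sum_erase S b hiS
      have h4 := hx i (hS hiS)
      omega
    obtain ⟨q', hq', g, hg, rfl⟩ := Submodule.mem_sup.1 hmod
    obtain ⟨q, hq, v, hv, rfl⟩ := Submodule.mem_sup.1 hq'
    obtain ⟨t, rfl⟩ := Ideal.mem_span_singleton'.1 hv
    have hg' := hle hg
    have ht := ihw (∑ i ∈ V, (m - (b + Pi.single x 1 : ι → ℕ) i)) (by
        rw [← hw]
        refine Finset.sum_lt_sum (fun i _ => ?_) ⟨x, hxV, ?_⟩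
        · simp only [Pi.add_apply]; omega
        · simp only [Pi.add_apply, Pi.single_eq_same]; omega)
      (b + Pi.single x 1) (f := t) (by
        intro S hS hSc
        have hgS : g ∈ Q ⊔ Ideal.span (F '' ↑S) ^ (m - ∑ i ∈ S, b i) := by
          refine Ideal.mem_sup_right (monomialSpan_le.2 (fun a ha => ?_) hg')
          exact prod_pow_mem_span_pow F a (by have := ha S hS hSc; omega)
        have hxt : F x * t ∈ Q ⊔ Ideal.span (F '' ↑S) ^ (m - ∑ i ∈ S, b i) := by
          have : F x * t = (q + t * F x + g) - q - g := by ring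
          rw [this]
          exact sub_mem (sub_mem (hf S hS hSc) (Ideal.mem_sup_left hq)) hgS
        rw [sum_add_single]
        split_ifs with hxS
        · rw [← Nat.sub_sub]
          exact h.mem_sup_pow_pred hS (by omega) hxS _ hxt
        · exact h.mem_sup_pow hS (by omega) hxV hxS _ hxt) rfl
    obtain ⟨q₁, hq₁, g₁, hg₁, rfl⟩ := Submodule.mem_sup.1 ht
    have hxg₁ : F x * g₁ ∈ monomialSpan F fun a => ∀ S ⊆ V, S.card = c + 1 →
        m ≤ ∑ i ∈ S, a i + ∑ i ∈ S, b i := by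
      refine (monomialSpan_le (I := Submodule.comap (LinearMap.mulLeft R (F x))
        (monomialSpan F fun a => ∀ S ⊆ V, S.card = c + 1 →
          m ≤ ∑ i ∈ S, a i + ∑ i ∈ S, b i))).2 (fun a ha => ?_) hg₁
      rw [Submodule.mem_comap, LinearMap.mulLeft_apply, mul_prod_pow]
      refine prod_pow_mem_monomialSpan fun S hS hSc => ?_
      have := ha S hS hSc
      rw [sum_add_single] at this ⊢
      omega
    have : q + (q₁ + g₁) * F x + g = (q + F x * q₁) + (g + F x * g₁) := by ring
    rw [this]
    exact Submodule.add_mem_sup (add_mem hq (Ideal.mul_mem_left _ _ hq₁)) (add_mem hg' hxg₁)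

end CommRing

theorem regularModulo_bot {R ι : Type*} [CommRing R] [DecidableEq ι] {F : ι → R} {N : ℕ}
    (h : ∀ L : List ι, L.Nodup → L.length ≤ N →
      RingTheory.Sequence.IsWeaklyRegular R (L.map F)) (V : Finset ι) :
    RegularModulo F ⊥ V N := by
  intro T _ hTN i _ hiT y hy
  have hL := h (T.toList ++ [i]) (by
    rw [List.nodup_append]
    refine ⟨T.nodup_toList, List.nodup_singleton i, ?_⟩
    rintro a ha b hb rfl
    simp_all) (by simpa using hTN)
  rw [List.map_append, RingTheory.Sequence.isWeaklyRegular_append_iff, List.map_singleton,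
    RingTheory.Sequence.isWeaklyRegular_singleton_iff,
    isSMulRegular_quotient_iff_mem_of_smul_mem] at hL
  have hspan : (Ideal.ofList (T.toList.map F) • ⊤ : Submodule R R) = Ideal.span (F '' ↑T) := by
    rw [smul_eq_mul, Ideal.mul_top]
    refine congrArg Ideal.span (Set.ext fun r => ?_)
    simp
  rw [hspan] at hL
  rw [bot_sup_eq] at hy ⊢
  exact hL.2 y hy

theorem card_lt_of_forall_le_sum {ι : Type*} {a : ι → ℕ} {e m : ℕ}
    (ha : ∀ S : Finset ι, S.card = e → m ≤ ∑ i ∈ S, a i) {Z B : Finset ι} (hZB : Z ⊆ B)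
    (hZ : Z.card ≤ e) (hB : ∀ S, Z ⊆ S → S ⊆ B → S.card = e → ∑ i ∈ S, a i < m) :
    B.card < e := by
  by_contra! h
  obtain ⟨S, hZS, hSB, hS⟩ := Finset.exists_subsuperset_card_eq hZB hZ h
  exact (ha S hS).not_gt (hB S hZS hSB hS)

section StarConfiguration

variable {k : Type*} [Field k] {n s : ℕ} {F : Fin s → MvPolynomial (Fin (n + 1)) k} {e : ℕ}

theorem mem_starSymb {m : ℕ} {f : MvPolynomial (Fin (n + 1)) k} :
    f ∈ starSymb F e m ↔ ∀ S : Finset (Fin s), S.card = e → f ∈ Ideal.span (F '' ↑S) ^ m := by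
  simp [starSymb]

theorem starIdeal_eq_starSymb_one : starIdeal F e = starSymb F e 1 := by
  simp [starIdeal, starSymb]

theorem starSymb_eq_monomialSpan (h : RegularModulo F ⊥ Finset.univ (e + 1)) (m : ℕ) :
    starSymb F e m = monomialSpan F fun a => ∀ S, S.card = e → m ≤ ∑ i ∈ S, a i := by
  apply le_antisymm
  · intro f hf
    simpa using h.mem_sup_monomialSpan m 0 (f := f) fun S _ hS => by
      simpa using mem_starSymb.1 hf S hS
  · exact monomialSpan_le.2 fun a ha => mem_starSymb.2 fun S hS =>
      prod_pow_mem_span_pow F a (ha S hS)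

theorem prod_pow_mem_starIdeal {a : Fin s → ℕ} (ha : (Finset.univ.filter (a · = 0)).card < e) :
    ∏ i, F i ^ a i ∈ starIdeal F e := by
  rw [starIdeal_eq_starSymb_one, mem_starSymb]
  intro S hS
  refine prod_pow_mem_span_pow F a ?_
  by_contra! h
  have hsub : S ⊆ Finset.univ.filter (a · = 0) := fun i hi => by
    have := Finset.single_le_sum_of_canonicallyOrdered (f := a) hi
    simp; omega
  have := Finset.card_le_card hsub
  omega

theorem card_zeros_lt {a : Fin s → ℕ} {m : ℕ} (hm : 0 < m)
    (ha : ∀ S : Finset (Fin s), S.card = e → m ≤ ∑ i ∈ S, a i) :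
    (Finset.univ.filter (a · = 0)).card < e := by
  refine card_lt_of_forall_le_sum ha (Finset.empty_subset _) (by simp) fun S _ hS _ => ?_
  rw [Finset.sum_eq_zero fun i hi => by simpa using hS hi]
  exact hm

theorem starIdeal_le_starSymb (h : RegularModulo F ⊥ Finset.univ (e + 1)) (j : ℕ) :
    starIdeal F e ≤ starSymb F (e + j) (j + 1) := by
  rw [starIdeal_eq_starSymb_one, starSymb_eq_monomialSpan h]
  refine monomialSpan_le.2 fun a ha => mem_starSymb.2 fun S hS => prod_pow_mem_span_pow F a ?_
  have h1 : (S.filter (a · = 0)).card < e :=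
    (Finset.card_le_card (Finset.filter_subset_filter _ (Finset.subset_univ S))).trans_lt
      (card_zeros_lt one_pos ha)
  have h2 := Finset.card_filter_add_card_filter_not (s := S) (a · = 0)
  have h3 : (S.filter (¬ a · = 0)).card ≤ ∑ i ∈ S, a i := by
    rw [Finset.card_filter]
    exact Finset.sum_le_sum fun i _ => by split_ifs <;> omega
  omega

theorem starIdeal_succ_eq_span (h : RegularModulo F ⊥ Finset.univ (e + 2)) (he : e ≤ s) :
    starIdeal F (e + 1) = Ideal.span
      ((fun U : Finset (Fin s) => ∏ i ∈ Uᶜ, F i) ''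
        ((Finset.univ.powersetCard e : Finset (Finset (Fin s))) : Set (Finset (Fin s)))) := by
  apply le_antisymm
  · rw [starIdeal_eq_starSymb_one, starSymb_eq_monomialSpan h]
    refine monomialSpan_le.2 fun a ha => ?_
    obtain ⟨U, hZU, -, hU⟩ := Finset.exists_subsuperset_card_eq
      (Finset.subset_univ (Finset.univ.filter (a · = 0)))
      (Nat.lt_succ_iff.1 (card_zeros_lt one_pos ha)) (by simpa using he)
    refine Ideal.mem_of_dvd _ ?_ (Ideal.subset_span (Set.mem_image_of_mem _
      (Finset.mem_powersetCard.2 ⟨Finset.subset_univ U, hU⟩)))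
    refine (Finset.prod_dvd_prod_of_dvd _ (fun i => F i ^ a i) fun i hi => ?_).trans
      (Finset.prod_dvd_prod_of_subset _ _ _ (Finset.subset_univ _))
    refine dvd_pow_self _ fun h0 => Finset.mem_compl.1 hi (hZU (by simpa using h0))
  · rw [Ideal.span_le, Set.image_subset_iff]
    intro U hU
    have hU := (Finset.mem_powersetCard.1 hU).2
    rw [Set.mem_preimage, SetLike.mem_coe, starIdeal_eq_starSymb_one, mem_starSymb]
    intro S hS
    obtain ⟨i, hiS, hiU⟩ := Finset.exists_mem_notMem_of_card_lt_card (by omega : U.card < S.card)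
    rw [pow_one]
    exact Ideal.mem_of_dvd _ (Finset.dvd_prod_of_mem F (Finset.mem_compl.2 hiU))
      (Ideal.subset_span (Set.mem_image_of_mem F hiS))

theorem prod_pow_mem_of_three_le_sum {d : ℕ} {a : Fin s → ℕ}
    (ha : ∀ S : Finset (Fin s), S.card = d + 3 → 3 ≤ ∑ i ∈ S, a i) :
    ∏ i, F i ^ a i ∈ starIdeal F (d + 1) + starIdeal F (d + 2) * starIdeal F (d + 3) +
      starIdeal F (d + 3) ^ 3 := by
  set Z := Finset.univ.filter (a · = 0) with hZdef
  have hZ : Z.card < d + 3 := card_zeros_lt (by norm_num) ha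
  have hZ0 : ∀ i ∈ Z, a i = 0 := fun i hi => by simpa [hZdef] using hi
  have hmin : Finset.univ.filter (fun i => min (a i) 1 = 0) = Z := by
    ext i; simp [hZdef]
  rcases lt_trichotomy Z.card (d + 1) with h | h | h
  · exact Ideal.mem_sup_left (Ideal.mem_sup_left (prod_pow_mem_starIdeal h))
  · refine Ideal.mem_sup_left (Ideal.mem_sup_right ?_)
    have hY : (Finset.univ.filter (fun i => a i - 1 = 0)).card < d + 3 := by
      refine card_lt_of_forall_le_sum ha (Z := Z) (fun i hi => ?_) (by omega) fun S hZS hSY hS => ?_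
      · simp [hZ0 i hi]
      · rw [← Finset.sum_sdiff hZS, Finset.sum_eq_zero hZ0, add_zero]
        refine (Finset.sum_le_card_nsmul _ _ 1 fun i hi => ?_).trans_lt ?_
        · have := hSY (Finset.mem_sdiff.1 hi).1
          simp at this
          omega
        · rw [Finset.card_sdiff_of_subset hZS, hS, h]
          simp
    have : ∏ i, F i ^ a i = (∏ i, F i ^ min (a i) 1) * ∏ i, F i ^ (a i - 1) := by
      rw [← Finset.prod_mul_distrib]
      refine Finset.prod_congr rfl fun i _ => ?_
      rw [← pow_add]
      congr 1
      omega
    rw [this]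
    exact Ideal.mul_mem_mul (prod_pow_mem_starIdeal (by rw [hmin]; omega))
      (prod_pow_mem_starIdeal hY)
  · refine Ideal.mem_sup_right ?_
    have h3 : ∀ i, a i = 0 ∨ 3 ≤ a i := by
      intro i
      by_cases hi : i ∈ Z
      · exact Or.inl (hZ0 i hi)
      · have := ha (insert i Z) (by rw [Finset.card_insert_of_notMem hi]; omega)
        rw [Finset.sum_insert hi, Finset.sum_eq_zero hZ0] at this
        exact Or.inr this
    have hsub : Finset.univ.filter (fun i => a i - 2 = 0) = Z := by
      ext i
      have := h3 i
      simp [hZdef]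
      omega
    have : ∏ i, F i ^ a i =
        (∏ i, F i ^ min (a i) 1) ^ 2 * ∏ i, F i ^ (a i - 2) := by
      rw [← Finset.prod_pow, ← Finset.prod_mul_distrib]
      refine Finset.prod_congr rfl fun i _ => ?_
      have := h3 i
      rw [← pow_mul, ← pow_add]
      congr 1
      omega
    rw [this, pow_succ _ 2]
    exact Ideal.mul_mem_mul (Ideal.pow_mem_pow (prod_pow_mem_starIdeal (by rw [hmin]; omega)) 2)
      (prod_pow_mem_starIdeal (by rw [hsub]; omega))

theorem RegularModulo.mono {R ι : Type*} [CommRing R] {F : ι → R} {Q : Ideal R} {V : Finset ι}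
    {M N : ℕ} (h : RegularModulo F Q V N) (hMN : M ≤ N) : RegularModulo F Q V M :=
  fun T hT hTM => h T hT (hTM.trans_le hMN)

theorem starSymb_three_eq {d : ℕ} (h : RegularModulo F ⊥ Finset.univ (d + 4)) :
    starSymb F (d + 3) 3 = starIdeal F (d + 1) + starIdeal F (d + 2) * starIdeal F (d + 3) +
      starIdeal F (d + 3) ^ 3 := by
  apply le_antisymm
  · rw [starSymb_eq_monomialSpan h]
    exact monomialSpan_le.2 fun a ha => prod_pow_mem_of_three_le_sum ha
  · refine sup_le (sup_le (starIdeal_le_starSymb (h.mono (by omega)) 2) ?_) ?_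
    · have h1 := starIdeal_le_starSymb (e := d + 2) (h.mono (by omega)) 1
      rw [starIdeal_eq_starSymb_one (e := d + 3)]
      refine le_iInf₂ fun S hS => ?_
      rw [pow_succ _ 2]
      refine Ideal.mul_mono (h1.trans fun f hf => mem_starSymb.1 hf S hS) fun f hf => ?_
      simpa using mem_starSymb.1 hf S hS
    · exact le_iInf₂ fun S hS => Ideal.pow_right_mono (iInf₂_le S hS) 3

end StarConfiguration

theorem star_symbolic_cube_decomposition (k : Type*) [Field k] (n s c : ℕ)
    (hc : 3 ≤ c) (hcn : c ≤ n) (hcs : c ≤ s)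
    (F : Fin s → MvPolynomial (Fin (n + 1)) k)
    (hF : ∀ i, ∃ d, 0 < d ∧ (F i).IsHomogeneous d)
    (hreg : ∀ L : List (Fin s), L.Nodup → L.length ≤ c + 1 →
      RingTheory.Sequence.IsRegular (MvPolynomial (Fin (n + 1)) k) (L.map F)) :
    starSymb F c 3 =
      starIdeal F (c - 2) + starIdeal F (c - 1) * starIdeal F c + starIdeal F c ^ 3 ∧
    ∃ T : Finset (MvPolynomial (Fin (n + 1)) k),
      T.card ≤ Nat.choose s (c - 3) + Nat.choose s (c - 2) * Nat.choose s (c - 1) ∧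
      (∀ f ∈ T, ∃ d, MvPolynomial.IsHomogeneous f d) ∧
      starSymb F c 3 = starIdeal F c ^ 3 + Ideal.span (T : Set (MvPolynomial (Fin (n + 1)) k)) := by
  classical
  obtain ⟨d, rfl⟩ : ∃ d, c = d + 3 := ⟨c - 3, by omega⟩
  have h : RegularModulo F ⊥ Finset.univ (d + 4) :=
    regularModulo_bot (fun L hL hLc => (hreg L hL hLc).toIsWeaklyRegular) _
  simp only [show d + 3 - 2 = d + 1 by omega, show d + 3 - 1 = d + 2 by omega,
    show d + 3 - 3 = d by omega]
  refine ⟨starSymb_three_eq h, ?_⟩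
  choose D _ hD using hF
  let G (e : ℕ) : Finset (MvPolynomial (Fin (n + 1)) k) :=
    (Finset.univ.powersetCard e).image fun U : Finset (Fin s) => ∏ i ∈ Uᶜ, F i
  have hGcard (e : ℕ) : (G e).card ≤ s.choose e :=
    Finset.card_image_le.trans (by simp [Finset.card_powersetCard])
  have hGhom {e : ℕ} {f} (hf : f ∈ G e) : ∃ d, MvPolynomial.IsHomogeneous f d := by
    obtain ⟨U, -, rfl⟩ := Finset.mem_image.1 hf
    exact ⟨_, MvPolynomial.IsHomogeneous.prod _ _ _ fun i _ => hD i⟩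
  refine ⟨G d ∪ Finset.image₂ (· * ·) (G (d + 1)) (G (d + 2)), ?_, ?_, ?_⟩
  · refine (Finset.card_union_le _ _).trans (add_le_add (hGcard d) ((Finset.card_image₂_le _ _ _).trans ?_))
    exact Nat.mul_le_mul (hGcard _) (hGcard _)
  · intro f hf
    rcases Finset.mem_union.1 hf with hf | hf
    · exact hGhom hf
    · obtain ⟨p, hp, q, hq, rfl⟩ := Finset.mem_image₂.1 hf
      obtain ⟨dp, hp⟩ := hGhom hp
      obtain ⟨dq, hq⟩ := hGhom hq
      exact ⟨_, hp.mul hq⟩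
  · have hG {e : ℕ} (he : e ≤ d + 2) : starIdeal F (e + 1) = Ideal.span ↑(G e) := by
      rw [starIdeal_succ_eq_span (h.mono (by omega)) (by omega), Finset.coe_image]
    rw [starSymb_three_eq h, add_comm (_ + _)]
    congr 1
    rw [hG (e := d) (by omega), hG (e := d + 1) (by omega), hG (e := d + 2) le_rfl,
      Ideal.span_mul_span', Finset.coe_union, Ideal.span_union,
      Finset.coe_image₂, Set.image2_mul]
    rfl
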